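/- There is a strictly decreasing ω-sequence for convex embeddability on linear orders on ℕ which is not bounded from below: there exists a sequence (L_n)_{n ∈ ℕ} of linear orders on ℕ such that for all n, L_{n+1} convexly embeds into L_n but L_n does not convexly embed into L_{n+1}, and for every linear order M on ℕ there exists n such that M does not convexly embed into L_n. -/

import Mathlib

/-- `L` convexly embeds into `L'` (`L ⊴ L'`). -/
def CvxEmb (L L' : LinearOrder ℕ) : Prop :=
  ∃ f : ℕ → ℕ, (∀ a b : ℕ, L.le a b ↔ L'.le (f a) (f b)) ∧
    ∀ x y z : ℕ, L'.le x y → L'.le y z →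
      x ∈ Set.range f → z ∈ Set.range f → y ∈ Set.range f

/-- An order embedding with convex range. -/
structure IsConvexEmbedding {α β : Type*} [LE α] [LE β] (f : α → β) : Prop where
  le_iff : ∀ a b, a ≤ b ↔ f a ≤ f b
  convex : ∀ x y z, x ≤ y → y ≤ z → x ∈ Set.range f → z ∈ Set.range f → y ∈ Set.range f

namespace IsConvexEmbedding

variable {α β γ : Type*} [LinearOrder α] [LinearOrder β] [LinearOrder γ]

lemma injective {f : α → β} (hf : IsConvexEmbedding f) : Function.Injective f := fun a b h =>
  le_antisymm ((hf.le_iff a b).2 h.le) ((hf.le_iff b a).2 h.ge)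

lemma comp {g : β → γ} {f : α → β} (hg : IsConvexEmbedding g) (hf : IsConvexEmbedding f) :
    IsConvexEmbedding (g ∘ f) where
  le_iff a b := (hf.le_iff a b).trans (hg.le_iff _ _)
  convex := by
    rintro _ y _ hxy hyz ⟨a, rfl⟩ ⟨c, rfl⟩
    obtain ⟨b, rfl⟩ := hg.convex _ y _ hxy hyz ⟨f a, rfl⟩ ⟨f c, rfl⟩
    obtain ⟨b, rfl⟩ := hf.convex _ b _ ((hg.le_iff _ _).2 hxy) ((hg.le_iff _ _).2 hyz)
      ⟨a, rfl⟩ ⟨c, rfl⟩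
    exact ⟨b, rfl⟩

lemma exists_factor {f : α → γ} {g : β → γ} (hf : IsConvexEmbedding f)
    (hg : IsConvexEmbedding g) (h : Set.range f ⊆ Set.range g) :
    ∃ k : α → β, IsConvexEmbedding k := by
  choose k hk using fun a => h ⟨a, rfl⟩
  refine ⟨k, fun a b => by rw [hf.le_iff, hg.le_iff, hk, hk], ?_⟩
  rintro _ y _ hxy hyz ⟨a, rfl⟩ ⟨c, rfl⟩
  rw [hg.le_iff, hk] at hxy hyz
  obtain ⟨b, hb⟩ := hf.convex _ _ _ hxy hyz ⟨a, rfl⟩ ⟨c, rfl⟩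
  exact ⟨b, hg.injective ((hk b).trans hb)⟩

lemma image_Icc {f : α → β} (hf : IsConvexEmbedding f) (a b : α) :
    f '' Set.Icc a b = Set.Icc (f a) (f b) := by
  ext y
  constructor
  · rintro ⟨x, ⟨hax, hxb⟩, rfl⟩
    exact ⟨(hf.le_iff _ _).1 hax, (hf.le_iff _ _).1 hxb⟩
  · rintro ⟨hay, hyb⟩
    obtain ⟨x, rfl⟩ := hf.convex _ _ _ hay hyb ⟨a, rfl⟩ ⟨b, rfl⟩
    exact ⟨x, ⟨(hf.le_iff _ _).2 hay, (hf.le_iff _ _).2 hyb⟩, rfl⟩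

lemma finite_Icc_iff {f : α → β} (hf : IsConvexEmbedding f) (a b : α) :
    (Set.Icc (f a) (f b)).Finite ↔ (Set.Icc a b).Finite := by
  rw [← hf.image_Icc, Set.finite_image_iff hf.injective.injOn]

end IsConvexEmbedding

/-- The rationals with every point replaced by a finite block, distinct points being replaced
by blocks of distinct sizes. -/
abbrev BlockSum : Type := Σₗ q : ℚ, Fin (Encodable.encode q + 1)

namespace BlockSum

/-- The index of the block containing a point. -/
def index (s : BlockSum) : ℚ := (ofLex s).1

/-- The first point of a block. -/
def first (q : ℚ) : BlockSum := toLex ⟨q, 0⟩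

@[simp]
lemma index_first (q : ℚ) : (first q).index = q := rfl

lemma first_injective : Function.Injective first := fun _ _ h => congrArg index h

lemma index_mono : Monotone index := by
  intro s t h
  rcases Sigma.Lex.le_def.1 h with h | ⟨h, -⟩
  · exact h.le
  · exact h.le

lemma lt_of_index_lt {s t : BlockSum} (h : s.index < t.index) : s < t :=
  index_mono.reflect_lt h

/-- A block is the image of its index type. -/
lemma range_block (q : ℚ) :
    Set.range (fun i : Fin (Encodable.encode q + 1) => (toLex ⟨q, i⟩ : BlockSum)) =
      {s : BlockSum | s.index = q} := by
  ext s
  constructor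
  · rintro ⟨i, rfl⟩
    rfl
  · rintro rfl
    exact ⟨(ofLex s).2, rfl⟩

lemma finite_block (q : ℚ) : {s : BlockSum | s.index = q}.Finite :=
  range_block q ▸ Set.finite_range _

lemma ncard_block (q : ℚ) : {s : BlockSum | s.index = q}.ncard = Encodable.encode q + 1 := by
  rw [← range_block, ← Set.image_univ, Set.ncard_image_of_injective, Set.ncard_univ, Nat.card_fin]
  intro i j h
  exact eq_of_heq (Sigma.mk.inj (toLex.injective h)).2

lemma finite_Icc_iff {s t : BlockSum} : (Set.Icc s t).Finite ↔ t.index ≤ s.index := by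
  constructor
  · intro h
    by_contra! hlt
    refine (Set.Ioo_infinite hlt).image first_injective.injOn (h.subset ?_)
    rintro _ ⟨q, ⟨hsq, hqt⟩, rfl⟩
    exact ⟨(lt_of_index_lt (t := first q) hsq).le, (lt_of_index_lt (s := first q) hqt).le⟩
  · intro h
    refine (finite_block s.index).subset fun u hu => ?_
    exact le_antisymm ((index_mono hu.2).trans h) (index_mono hu.1)

section

variable {α : Type*} [LinearOrder α] {f g : α → BlockSum}

/-- The relation between blocks does not depend on the convex embedding. -/
lemma index_le_iff (hf : IsConvexEmbedding f) (hg : IsConvexEmbedding g) (a b : α) :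
    (f a).index ≤ (f b).index ↔ (g a).index ≤ (g b).index := by
  rw [← finite_Icc_iff, ← finite_Icc_iff, hf.finite_Icc_iff, hg.finite_Icc_iff]

lemma ncard_setOf_index_eq (hf : IsConvexEmbedding f) {a x b : α}
    (hax : (f a).index < (f x).index) (hxb : (f x).index < (f b).index) :
    {y | (f y).index = (f x).index}.ncard = Encodable.encode (f x).index + 1 := by
  rw [← ncard_block, ← Set.ncard_image_of_injective _ hf.injective]
  congr 1
  ext s
  constructor
  · rintro ⟨y, hy, rfl⟩
    exact hy
  · intro hs
    rw [Set.mem_ofPred_eq] at hs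
    obtain ⟨y, rfl⟩ := hf.convex _ s _ (lt_of_index_lt (hs ▸ hax)).le
      (lt_of_index_lt (hs ▸ hxb)).le ⟨a, rfl⟩ ⟨b, rfl⟩
    exact ⟨y, hs, rfl⟩

/-- The block of an interior point does not depend on the convex embedding. -/
lemma index_eq_of_lt_of_lt (hf : IsConvexEmbedding f) (hg : IsConvexEmbedding g) {a x b : α}
    (hax : (f a).index < (f x).index) (hxb : (f x).index < (f b).index) :
    (f x).index = (g x).index := by
  have key := index_le_iff hf hg
  have hfx := ncard_setOf_index_eq hf hax hxb
  rw [← not_le, key, not_le] at hax hxb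
  have hgx := ncard_setOf_index_eq hg hax hxb
  have hset : {y | (f y).index = (f x).index} = {y | (g y).index = (g x).index} := by
    ext y
    simp [le_antisymm_iff, key]
  rw [hset] at hfx
  exact Encodable.encode_injective (Nat.succ_injective (hfx.symm.trans hgx))

lemma exists_index_lt_lt [Infinite α] (hf : IsConvexEmbedding f) :
    ∃ a x b, (f a).index < (f x).index ∧ (f x).index < (f b).index := by
  obtain ⟨a, b, hab⟩ : ∃ a b, (f a).index < (f b).index := by
    by_contra! h
    obtain ⟨c⟩ := (inferInstance : Nonempty α)
    refine Set.infinite_range_of_injective hf.injective ((finite_block (f c).index).subset ?_)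
    rintro _ ⟨a, rfl⟩
    exact le_antisymm (h _ _) (h _ _)
  obtain ⟨q, haq, hqb⟩ := exists_between hab
  obtain ⟨x, hx⟩ := hf.convex _ (first q) _ (lt_of_index_lt (t := first q) haq).le
    (lt_of_index_lt (s := first q) hqb).le
    ⟨a, rfl⟩ ⟨b, rfl⟩
  exact ⟨a, x, b, by simpa [hx], by simpa [hx]⟩

end

/-- The blocks indexed by positive rationals below `r` form a copy of a linear order on `ℕ`. -/
lemma exists_linearOrder_range_eq {r : ℚ} (hr : 0 < r) :
    ∃ (L : LinearOrder ℕ) (f : ℕ → BlockSum), @IsConvexEmbedding _ _ L.toLE _ f ∧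
      Set.range f = {s | s.index ∈ Set.Ioo 0 r} := by
  have : Countable BlockSum := inferInstanceAs (Countable (Σ q : ℚ, Fin (Encodable.encode q + 1)))
  have hinf : {s : BlockSum | s.index ∈ Set.Ioo 0 r}.Infinite :=
    ((Set.Ioo_infinite hr).image first_injective.injOn).mono (by rintro _ ⟨q, hq, rfl⟩; exact hq)
  have := hinf.to_subtype
  obtain ⟨e⟩ := nonempty_equiv_of_countable (α := ℕ) (β := {s : BlockSum | s.index ∈ Set.Ioo 0 r})
  have hrange : Set.range (fun n => (e n : BlockSum)) = {s | s.index ∈ Set.Ioo 0 r} :=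
    (e.surjective.range_comp Subtype.val).trans Subtype.range_coe
  refine ⟨LinearOrder.lift' (fun n => (e n : BlockSum))
    (Subtype.val_injective.comp e.injective), fun n => e n, ?_, hrange⟩
  refine @IsConvexEmbedding.mk _ _ (_) _ _ (fun _ _ => Iff.rfl) ?_
  rw [hrange]
  intro x y z hxy hyz hx hz
  exact ⟨hx.1.trans_le (index_mono hxy), (index_mono hyz).trans_lt hz.2⟩

end BlockSum

open IsConvexEmbedding in
lemma cvxEmb_iff_exists_isConvexEmbedding (L L' : LinearOrder ℕ) :
    CvxEmb L L' ↔ ∃ f : ℕ → ℕ, @IsConvexEmbedding ℕ ℕ L.toLE L'.toLE f :=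
  exists_congr fun f =>
    ⟨fun h => @IsConvexEmbedding.mk _ _ L.toLE L'.toLE f h.1 h.2,
      fun h => ⟨@le_iff _ _ L.toLE L'.toLE f h, @convex _ _ L.toLE L'.toLE f h⟩⟩

open BlockSum in
/-- There is a strictly `⊴`-decreasing `ω`-sequence of linear orders on `ℕ`
which is not bounded from below. -/
theorem cvxEmb_decreasing_sequence_unbounded_below :
    ∃ L : ℕ → LinearOrder ℕ,
      (∀ n : ℕ, CvxEmb (L (n + 1)) (L n) ∧ ¬ CvxEmb (L n) (L (n + 1))) ∧
      ∀ M : LinearOrder ℕ, ∃ n : ℕ, ¬ CvxEmb M (L n) := by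
  choose L g hg hrange using fun n : ℕ =>
    exists_linearOrder_range_eq (r := 1 / ((n : ℚ) + 1)) Nat.one_div_pos_of_nat
  have hmem (n i : ℕ) : (g n i).index ∈ Set.Ioo 0 (1 / ((n : ℚ) + 1)) :=
    (hrange n).subset ⟨i, rfl⟩
  have hsurj (n : ℕ) {q : ℚ} (hq : q ∈ Set.Ioo 0 (1 / ((n : ℚ) + 1))) :
      ∃ i, (g n i).index = q := by
    obtain ⟨i, hi⟩ := (hrange n).superset (show first q ∈ _ from hq)
    exact ⟨i, by rw [hi, index_first]⟩
  have hlt (n : ℕ) : 1 / (((n + 1 : ℕ) : ℚ) + 1) < 1 / ((n : ℚ) + 1) :=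
    Nat.one_div_lt_one_div n.lt_succ_self
  refine ⟨L, fun n => ⟨?_, ?_⟩, fun M => ?_⟩
  · rw [cvxEmb_iff_exists_isConvexEmbedding]
    refine @IsConvexEmbedding.exists_factor ℕ ℕ BlockSum (L (n + 1)) (L n) _ _ _
      (hg (n + 1)) (hg n) ?_
    rw [hrange, hrange]
    exact fun s hs => ⟨hs.1, hs.2.trans (hlt n)⟩
  · rw [cvxEmb_iff_exists_isConvexEmbedding]
    rintro ⟨f, hf⟩
    obtain ⟨q, hnq, hqn⟩ := exists_between (hlt n)
    have hpos : (0 : ℚ) < 1 / (((n + 1 : ℕ) : ℚ) + 1) := Nat.one_div_pos_of_nat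
    obtain ⟨x, rfl⟩ := hsurj n ⟨hpos.trans hnq, hqn⟩
    obtain ⟨p, hxp, hpn⟩ := exists_between hqn
    obtain ⟨a, ha⟩ := hsurj n ⟨hpos, hlt n⟩
    obtain ⟨b, rfl⟩ := hsurj n ⟨hpos.trans (hnq.trans hxp), hpn⟩
    have heq := @index_eq_of_lt_of_lt ℕ (L n) _ _ (hg n)
      (@IsConvexEmbedding.comp ℕ ℕ BlockSum (L n) (L (n + 1)) _ _ _ (hg (n + 1)) hf)
      a x b (ha ▸ hnq) hxp
    exact (hnq.trans_eq heq).not_gt (hmem (n + 1) (f x)).2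
  · by_contra! h
    simp only [cvxEmb_iff_exists_isConvexEmbedding] at h
    choose f hf using h
    have hgf (n : ℕ) := @IsConvexEmbedding.comp ℕ ℕ BlockSum M (L n) _ _ _ (hg n) (hf n)
    obtain ⟨a, x, b, hax, hxb⟩ := @exists_index_lt_lt ℕ M _ _ (hgf 0)
    obtain ⟨n, hn⟩ := exists_nat_one_div_lt (hmem 0 (f 0 x)).1
    have heq := @index_eq_of_lt_of_lt ℕ M _ _ (hgf 0) (hgf n) _ _ _ hax hxb
    exact (hn.trans_eq heq).not_gt (hmem n (f n x)).2
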